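/- arXiv:2405.04205 — 2 statements merged into one kernel-verified Lean document; each statement's English description precedes it below -/
import Mathlib

section
/- The Darboux map φ⁻¹ has the asymptotic expansion φ⁻¹(x,y) = (x,y) + (ν/4)(x²+y²)·(x,y) + O(‖(x,y)‖⁵): there exist constants C > 0 and r₀ > 0 such that for all (x,y) with ν(x²+y²) ≤ r₀, ‖φ⁻¹(x,y) − (1 + (ν/4)(x²+y²))·(x,y)‖ ≤ C·ν²·‖(x,y)‖⁵. -/
/-- `σ(s) = √((exp s − 1)/s)` for `s ≠ 0`, `σ(0) = 1`. -/
noncomputable def sigmaFun (s : ℝ) : ℝ :=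
  if s = 0 then 1 else Real.sqrt ((Real.exp s - 1) / s)

/-- The Darboux map `φ⁻¹(x,y) = (x·σ(ν(x²+y²)), y·σ(ν(x²+y²)))`. -/
noncomputable def phiInv (ν : ℝ) (v : ℝ × ℝ) : ℝ × ℝ :=
  (v.1 * sigmaFun (ν * (v.1 ^ 2 + v.2 ^ 2)), v.2 * sigmaFun (ν * (v.1 ^ 2 + v.2 ^ 2)))

/-- Second-order Taylor bound `|σ(s) − (1 + s/4)| ≤ s²` on `[0, 1]`. -/
theorem abs_sigmaFun_sub_le {s : ℝ} (h0 : 0 ≤ s) (h1 : s ≤ 1) :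
    |sigmaFun s - (1 + s / 4)| ≤ s ^ 2 := by
  rcases h0.eq_or_lt with rfl | hs
  · simp [sigmaFun]
  have hexp : |Real.exp s - (1 + s + s ^ 2 / 2)| ≤ s ^ 3 * (2 / 9) := by
    have h := Real.exp_bound (x := s) (by rwa [abs_of_pos hs]) (n := 3) (by norm_num)
    norm_num [Finset.sum_range_succ, Nat.factorial, abs_of_pos hs] at h
    exact h
  set q := (Real.exp s - 1) / s with hq
  have hqs : Real.exp s = 1 + q * s := by
    rw [hq]
    field_simp
    ring
  have hquot : |q - (1 + s / 2)| ≤ 2 / 9 * s ^ 2 := by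
    have h : Real.exp s - (1 + s + s ^ 2 / 2) = s * (q - (1 + s / 2)) := by
      rw [hqs]
      ring
    rw [h, abs_mul, abs_of_pos hs] at hexp
    refine le_of_mul_le_mul_left ?_ hs
    linarith
  have hq0 : 0 ≤ q := div_nonneg (by linarith [Real.add_one_le_exp s]) h0
  have hsq : Real.sqrt q ^ 2 = q := Real.sq_sqrt hq0
  have hr0 := Real.sqrt_nonneg q
  have hsigma : sigmaFun s = Real.sqrt q := by simp [sigmaFun, hs.ne', hq]
  rw [hsigma]
  have hfactor : |Real.sqrt q - (1 + s / 4)| * (Real.sqrt q + (1 + s / 4)) =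
      |q - (1 + s / 4) ^ 2| := by
    have hpos : |Real.sqrt q + (1 + s / 4)| = Real.sqrt q + (1 + s / 4) :=
      abs_of_nonneg (by positivity)
    rw [← hpos, ← abs_mul]
    congr 1
    linear_combination hsq
  calc |Real.sqrt q - (1 + s / 4)|
      ≤ |Real.sqrt q - (1 + s / 4)| * (Real.sqrt q + (1 + s / 4)) :=
        le_mul_of_one_le_right (abs_nonneg _) (by linarith)
    _ = |q - (1 + s / 4) ^ 2| := hfactor
    _ ≤ s ^ 2 := by
        rw [abs_le] at hquot ⊢
        constructor <;> nlinarith [hquot.1, hquot.2, sq_nonneg s]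

/-- Asymptotic expansion `φ⁻¹(x,y) = (x,y) + (ν/4)(x²+y²)·(x,y) + O(‖(x,y)‖⁵)`:
there exist `C > 0` and `r₀ > 0` such that for all `(x,y)` with `ν(x²+y²) ≤ r₀`,
`‖φ⁻¹(x,y) − (1 + (ν/4)(x²+y²))·(x,y)‖ ≤ C·ν²·‖(x,y)‖⁵`. -/
theorem stmt2 (ν : ℝ) (hν : 0 < ν) :
    ∃ C > (0 : ℝ), ∃ r₀ > (0 : ℝ), ∀ x y : ℝ, ν * (x ^ 2 + y ^ 2) ≤ r₀ →
      Real.sqrt (((phiInv ν (x, y)).1 - (1 + ν / 4 * (x ^ 2 + y ^ 2)) * x) ^ 2 +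
          ((phiInv ν (x, y)).2 - (1 + ν / 4 * (x ^ 2 + y ^ 2)) * y) ^ 2)
        ≤ C * ν ^ 2 * Real.sqrt (x ^ 2 + y ^ 2) ^ 5 := by
  refine ⟨1, one_pos, 1, one_pos, fun x y hxy => ?_⟩
  have hR : 0 ≤ x ^ 2 + y ^ 2 := by positivity
  have hd := abs_sigmaFun_sub_le (mul_nonneg hν.le hR) hxy
  have hsq := Real.sq_sqrt hR
  have hr0 := Real.sqrt_nonneg (x ^ 2 + y ^ 2)
  simp only [phiInv]
  set d := sigmaFun (ν * (x ^ 2 + y ^ 2)) - (1 + ν * (x ^ 2 + y ^ 2) / 4) with hdef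
  have hsum : (x * sigmaFun (ν * (x ^ 2 + y ^ 2)) - (1 + ν / 4 * (x ^ 2 + y ^ 2)) * x) ^ 2 +
      (y * sigmaFun (ν * (x ^ 2 + y ^ 2)) - (1 + ν / 4 * (x ^ 2 + y ^ 2)) * y) ^ 2 =
      (x ^ 2 + y ^ 2) * d ^ 2 := by
    rw [hdef]
    ring
  rw [hsum, Real.sqrt_mul hR, Real.sqrt_sq_eq_abs]
  calc Real.sqrt (x ^ 2 + y ^ 2) * |d|
      ≤ Real.sqrt (x ^ 2 + y ^ 2) * (ν * (x ^ 2 + y ^ 2)) ^ 2 := by gcongr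
    _ = Real.sqrt (x ^ 2 + y ^ 2) * (ν * Real.sqrt (x ^ 2 + y ^ 2) ^ 2) ^ 2 := by rw [hsq]
    _ = 1 * ν ^ 2 * Real.sqrt (x ^ 2 + y ^ 2) ^ 5 := by ring
end

section
/- The inverse of the Darboux map φ⁻¹ has the asymptotic expansion φ(q,p) ∼ (1 − (ν/4)(q²+p²))·(q,p): there exist constants ρ₀ > 0 and C > 0 such that for every (q,p) ∈ ℝ² with ‖(q,p)‖ ≤ ρ₀ there is a unique (x,y) with ‖(x,y)‖ ≤ 2ρ₀ and φ⁻¹(x,y) = (q,p), and this (x,y) satisfies ‖(x,y) − (1 − (ν/4)(q²+p²))·(q,p)‖ ≤ C·ν²·‖(q,p)‖⁵. -/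
lemma sigmaFun_pos (s : ℝ) : 0 < sigmaFun s := by
  unfold sigmaFun
  split_ifs with h
  · exact one_pos
  · apply Real.sqrt_pos.2
    rcases lt_or_gt_of_ne h with h | h
    · exact div_pos_of_neg_of_neg (by linarith [Real.exp_lt_one_iff.2 h]) h
    · exact div_pos (by linarith [Real.one_lt_exp_iff.2 h]) h

lemma sigmaFun_sq_mul (s : ℝ) : sigmaFun s ^ 2 * s = Real.exp s - 1 := by
  by_cases h : s = 0
  · simp [h]
  · have hpos := sigmaFun_pos s
    unfold sigmaFun at hpos ⊢
    rw [if_neg h] at hpos ⊢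
    rw [Real.sq_sqrt (Real.sqrt_pos.1 hpos).le, div_mul_cancel₀ _ h]

lemma log_one_add_le_cubic {t : ℝ} (h0 : 0 ≤ t) (h1 : t ≤ 1) :
    Real.log (1 + t) ≤ t - t ^ 2 / 2 + 5 / 8 * t ^ 3 := by
  have hs0 : 0 ≤ Real.log (1 + t) := Real.log_nonneg (by linarith)
  have hlow := Real.le_log_one_add_of_nonneg h0
  have hexp := Real.quadratic_le_exp_of_nonneg hs0
  rw [Real.exp_log (by linarith)] at hexp
  have hlow' : t - t ^ 2 / 2 ≤ 2 * t / (t + 2) := by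
    rw [le_div_iff₀ (by linarith)]
    nlinarith [pow_nonneg h0 3]
  have hsq : (t - t ^ 2 / 2) ^ 2 ≤ Real.log (1 + t) ^ 2 :=
    pow_le_pow_left₀ (by nlinarith) (hlow'.trans hlow) 2
  nlinarith [pow_nonneg h0 3, pow_nonneg h0 4]

lemma abs_inv_sigmaFun_log_sub_le {t : ℝ} (h0 : 0 ≤ t) (h1 : t ≤ 1) :
    |(sigmaFun (Real.log (1 + t)))⁻¹ - (1 - t / 4)| ≤ t ^ 2 := by
  rcases h0.eq_or_lt with rfl | ht
  · simp [sigmaFun]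
  have hσ := sigmaFun_pos (Real.log (1 + t))
  have hσs := sigmaFun_sq_mul (Real.log (1 + t))
  rw [Real.exp_log (by linarith)] at hσs
  set τ := (sigmaFun (Real.log (1 + t)))⁻¹ with hτ
  have hτ0 : 0 < τ := inv_pos.2 hσ
  have hτs : τ ^ 2 * t = Real.log (1 + t) := by
    rw [hτ, inv_pow, inv_mul_eq_iff_eq_mul₀ (by positivity), hσs]
    ring
  have hlow : t - t ^ 2 / 2 ≤ Real.log (1 + t) := by
    refine le_trans ?_ (Real.le_log_one_add_of_nonneg h0)
    rw [le_div_iff₀ (by linarith)]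
    nlinarith [pow_nonneg h0 3]
  have hup : Real.log (1 + t) ≤ t - t ^ 2 / 2 + 5 / 8 * t ^ 3 := log_one_add_le_cubic h0 h1
  have hlow' : 1 - t / 2 ≤ τ ^ 2 := le_of_mul_le_mul_right (by nlinarith) ht
  have hup' : τ ^ 2 ≤ 1 - t / 2 + 5 / 8 * t ^ 2 := le_of_mul_le_mul_right (by nlinarith) ht
  have hfac : (τ - (1 - t / 4)) * (τ + (1 - t / 4)) = τ ^ 2 - (1 - t / 2) - t ^ 2 / 16 := by ring
  rw [abs_le]
  constructor <;> by_contra! hc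
  · nlinarith [sq_nonneg t, mul_pos (sub_pos.2 hc) (show 0 < τ + (1 - t / 4) by linarith)]
  · nlinarith [sq_nonneg t, mul_pos (sub_pos.2 hc) (show 0 < τ + (1 - t / 4) by linarith)]

lemma phiInv_eq_iff {ν : ℝ} (hν : 0 < ν) (v : ℝ × ℝ) (q p : ℝ) :
    phiInv ν v = (q, p) ↔
      v = ((sigmaFun (Real.log (1 + ν * (q ^ 2 + p ^ 2))))⁻¹ * q,
        (sigmaFun (Real.log (1 + ν * (q ^ 2 + p ^ 2))))⁻¹ * p) := by
  constructor
  · intro h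
    obtain ⟨hq, hp⟩ := Prod.mk.inj h
    have hσ := sigmaFun_sq_mul (ν * (v.1 ^ 2 + v.2 ^ 2))
    have hlog : Real.log (1 + ν * (q ^ 2 + p ^ 2)) = ν * (v.1 ^ 2 + v.2 ^ 2) := by
      rw [← Real.log_exp (ν * (v.1 ^ 2 + v.2 ^ 2))]
      congr 1
      rw [← hq, ← hp]
      linear_combination hσ
    have hne := (sigmaFun_pos (ν * (v.1 ^ 2 + v.2 ^ 2))).ne'
    rw [hlog]
    ext
    · rw [eq_inv_mul_iff_mul_eq₀ hne, mul_comm, hq]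
    · rw [eq_inv_mul_iff_mul_eq₀ hne, mul_comm, hp]
  · rintro rfl
    have hσ := sigmaFun_sq_mul (Real.log (1 + ν * (q ^ 2 + p ^ 2)))
    rw [Real.exp_log (by positivity)] at hσ
    have hne := (sigmaFun_pos (Real.log (1 + ν * (q ^ 2 + p ^ 2)))).ne'
    have hs : ν * (((sigmaFun (Real.log (1 + ν * (q ^ 2 + p ^ 2))))⁻¹ * q) ^ 2 +
        ((sigmaFun (Real.log (1 + ν * (q ^ 2 + p ^ 2))))⁻¹ * p) ^ 2) =
        Real.log (1 + ν * (q ^ 2 + p ^ 2)) := by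
      field_simp
      linear_combination -hσ
    simp only [phiInv, hs]
    ext <;> field_simp

/-- The inverse of the Darboux map `φ⁻¹` has the asymptotic expansion
`φ(q,p) ∼ (1 − (ν/4)(q²+p²))·(q,p)`: there exist `ρ₀ > 0` and `C > 0` such that
for every `(q,p)` with `‖(q,p)‖ ≤ ρ₀` there is a unique `(x,y)` with
`‖(x,y)‖ ≤ 2ρ₀` and `φ⁻¹(x,y) = (q,p)`, and this `(x,y)` satisfies
`‖(x,y) − (1 − (ν/4)(q²+p²))·(q,p)‖ ≤ C·ν²·‖(q,p)‖⁵`. -/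
theorem stmt3 (ν : ℝ) (hν : 0 < ν) :
    ∃ ρ₀ > (0 : ℝ), ∃ C > (0 : ℝ), ∀ q p : ℝ, Real.sqrt (q ^ 2 + p ^ 2) ≤ ρ₀ →
      ∃ v : ℝ × ℝ,
        (Real.sqrt (v.1 ^ 2 + v.2 ^ 2) ≤ 2 * ρ₀ ∧ phiInv ν v = (q, p) ∧
          Real.sqrt ((v.1 - (1 - ν / 4 * (q ^ 2 + p ^ 2)) * q) ^ 2 +
              (v.2 - (1 - ν / 4 * (q ^ 2 + p ^ 2)) * p) ^ 2)
            ≤ C * ν ^ 2 * Real.sqrt (q ^ 2 + p ^ 2) ^ 5) ∧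
        ∀ w : ℝ × ℝ, Real.sqrt (w.1 ^ 2 + w.2 ^ 2) ≤ 2 * ρ₀ → phiInv ν w = (q, p) → w = v := by
  refine ⟨(Real.sqrt ν)⁻¹, by positivity, 1, one_pos, fun q p hqp => ?_⟩
  have hT0 : 0 ≤ ν * (q ^ 2 + p ^ 2) := by positivity
  have hT1 : ν * (q ^ 2 + p ^ 2) ≤ 1 := by
    rw [← Real.sqrt_inv, Real.sqrt_le_sqrt_iff (by positivity)] at hqp
    calc ν * (q ^ 2 + p ^ 2) ≤ ν * ν⁻¹ := by gcongr
      _ = 1 := mul_inv_cancel₀ hν.ne'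
  have hτ := abs_inv_sigmaFun_log_sub_le hT0 hT1
  have hτ0 := inv_pos.2 (sigmaFun_pos (Real.log (1 + ν * (q ^ 2 + p ^ 2))))
  have hiff := fun v => phiInv_eq_iff hν v q p
  set τ := (sigmaFun (Real.log (1 + ν * (q ^ 2 + p ^ 2))))⁻¹
  have hscale : ∀ a : ℝ, Real.sqrt ((a * q) ^ 2 + (a * p) ^ 2) =
      |a| * Real.sqrt (q ^ 2 + p ^ 2) := fun a => by
    rw [← Real.sqrt_sq_eq_abs, ← Real.sqrt_mul (sq_nonneg a)]
    congr 1
    ring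
  refine ⟨(τ * q, τ * p), ⟨?_, (hiff _).2 rfl, ?_⟩, fun w _ hw => (hiff w).1 hw⟩
  · have hτ2 : τ ≤ 2 := by
      nlinarith [(abs_le.1 hτ).2]
    rw [hscale, abs_of_pos hτ0]
    gcongr
  · rw [← sub_mul, ← sub_mul, hscale]
    have hR := Real.sq_sqrt (show 0 ≤ q ^ 2 + p ^ 2 by positivity)
    calc |τ - (1 - ν / 4 * (q ^ 2 + p ^ 2))| * Real.sqrt (q ^ 2 + p ^ 2)
        ≤ (ν * (q ^ 2 + p ^ 2)) ^ 2 * Real.sqrt (q ^ 2 + p ^ 2) := by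
          gcongr
          rwa [div_mul_eq_mul_div]
      _ = 1 * ν ^ 2 * Real.sqrt (q ^ 2 + p ^ 2) ^ 5 := by
          linear_combination (-ν ^ 2 * Real.sqrt (q ^ 2 + p ^ 2) *
            (Real.sqrt (q ^ 2 + p ^ 2) ^ 2 + (q ^ 2 + p ^ 2))) * hR
end
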